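/- arXiv:1502.05317 — 4 statements merged into one kernel-verified Lean document; each statement's English description precedes it below -/
import Mathlib

section
/- Let k, a : ℝ with k ≠ 0, and define A : ℝ → ℝ → ℝ by A R θ = a * Real.log (Real.tan (θ/2)) * Real.cos (k*R) / R. Then for every R with 0 < R and every θ with 0 < θ < π, the azimuthally symmetric spherical Helmholtz equation holds at (R, θ): deriv (deriv (fun r => A r θ)) R + (2/R) * deriv (fun r => A r θ) R + (1/R^2) * (deriv (deriv (fun t => A R t)) θ + (Real.cos θ / Real.sin θ) * deriv (fun t => A R t) θ) + k^2 * A R θ = 0. -/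
theorem aux_radial1 (C k r : ℝ) (hr : 0 < r) :
    HasDerivAt (fun r => C * Real.cos (k*r) / r)
      (C * (-(k * Real.sin (k*r)) * r - Real.cos (k*r)) / r^2) r := by
  have h1 : HasDerivAt (fun r : ℝ => k * r) k r := by
    simpa using (hasDerivAt_id r).const_mul k
  have h := ((h1.cos).const_mul C).div (hasDerivAt_id r) hr.ne'
  refine h.congr_deriv ?_
  simp only [id]
  ring

theorem aux_radial2 (C k r : ℝ) (hr : 0 < r) :
    HasDerivAt (fun r => C * (-(k * Real.sin (k*r)) * r - Real.cos (k*r)) / r^2)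
      (C * (-(k^2 * Real.cos (k*r)) / r + 2 * k * Real.sin (k*r) / r^2
        + 2 * Real.cos (k*r) / r^3)) r := by
  have h1 : HasDerivAt (fun r : ℝ => k * r) k r := by
    simpa using (hasDerivAt_id r).const_mul k
  have h := ((((h1.sin.const_mul k).neg.mul (hasDerivAt_id r)).sub h1.cos).const_mul C).div
    (hasDerivAt_pow 2 r) (pow_ne_zero 2 hr.ne')
  refine h.congr_deriv ?_
  have := hr.ne'
  simp
  field_simp
  ring

theorem aux_ang1 (a D t : ℝ) (h0 : 0 < t) (hp : t < Real.pi) :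
    HasDerivAt (fun t => a * Real.log (Real.tan (t/2)) * D) (a * D * (Real.sin t)⁻¹) t := by
  have hs : 0 < Real.sin (t/2) := Real.sin_pos_of_pos_of_lt_pi (by linarith) (by linarith)
  have hc : 0 < Real.cos (t/2) := Real.cos_pos_of_mem_Ioo ⟨by linarith, by linarith⟩
  have h1 : HasDerivAt (fun t : ℝ => t / 2) (1/2) t := (hasDerivAt_id t).div_const 2
  have h2 := (Real.hasDerivAt_tan hc.ne').comp t h1
  have h3 := h2.log (by
    simp only [Function.comp, Real.tan_eq_sin_div_cos]; positivity)
  refine ((h3.const_mul a).mul_const D).congr_deriv ?_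
  have e : Real.sin t = 2 * Real.sin (t/2) * Real.cos (t/2) := by
    rw [← Real.sin_two_mul]; congr 1; ring
  simp only [Function.comp, Real.tan_eq_sin_div_cos]
  rw [e]
  field_simp

theorem helmholtz_solution_cos_branch (k a : ℝ) (hk : k ≠ 0)
    (A : ℝ → ℝ → ℝ)
    (hA : A = fun R θ => a * Real.log (Real.tan (θ/2)) * Real.cos (k*R) / R)
    (R θ : ℝ) (hR : 0 < R) (hθ0 : 0 < θ) (hθπ : θ < Real.pi) :
    deriv (deriv (fun r => A r θ)) R + (2/R) * deriv (fun r => A r θ) R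
      + (1/R^2) * (deriv (deriv (fun t => A R t)) θ
        + (Real.cos θ / Real.sin θ) * deriv (fun t => A R t) θ)
      + k^2 * A R θ = 0 := by
  subst hA
  have hs : 0 < Real.sin θ := Real.sin_pos_of_pos_of_lt_pi hθ0 hθπ
  simp only [mul_div_assoc _ (Real.cos (k * R)) R]
  generalize hC : a * Real.log (Real.tan (θ/2)) = C
  have e1 : deriv (deriv (fun r => C * Real.cos (k*r) / r)) R
      = C * (-(k^2 * Real.cos (k*R)) / R + 2 * k * Real.sin (k*R) / R^2
        + 2 * Real.cos (k*R) / R^3) := by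
    refine Filter.EventuallyEq.deriv_eq ?_ |>.trans (aux_radial2 C k R hR).deriv
    filter_upwards [lt_mem_nhds hR] with r hr
    exact (aux_radial1 C k r hr).deriv
  have e2 : deriv (deriv (fun t => a * Real.log (Real.tan (t/2)) * (Real.cos (k*R) / R))) θ
      = a * (Real.cos (k*R) / R) * (-Real.cos θ / Real.sin θ ^ 2) := by
    refine Filter.EventuallyEq.deriv_eq ?_ |>.trans
      (((Real.hasDerivAt_sin θ).inv hs.ne').const_mul (a * (Real.cos (k*R) / R))).deriv
    filter_upwards [lt_mem_nhds hθ0, gt_mem_nhds hθπ] with t h0 h1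
    exact (aux_ang1 a _ t h0 h1).deriv
  rw [e1, e2, (aux_radial1 C k R hR).deriv, (aux_ang1 a _ θ hθ0 hθπ).deriv]
  have := hR.ne'
  field_simp
  ring
end

section
/- Let k, a : ℝ with k ≠ 0, and define A : ℝ → ℝ → ℝ by A R θ = a * Real.log (Real.tan (θ/2)) * Real.sin (k*R) / R. Then for every R with 0 < R and every θ with 0 < θ < π, the azimuthally symmetric spherical Helmholtz equation holds at (R, θ): deriv (deriv (fun r => A r θ)) R + (2/R) * deriv (fun r => A r θ) R + (1/R^2) * (deriv (deriv (fun t => A R t)) θ + (Real.cos θ / Real.sin θ) * deriv (fun t => A R t) θ) + k^2 * A R θ = 0. -/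
theorem helmholtz_aux_log {t : ℝ} (h0 : 0 < t) (h1 : t < Real.pi) :
    HasDerivAt (fun t : ℝ => Real.log (Real.tan (t/2))) (1 / Real.sin t) t := by
  have hs : 0 < Real.sin (t/2) := Real.sin_pos_of_pos_of_lt_pi (by linarith) (by linarith)
  have hc : 0 < Real.cos (t/2) := Real.cos_pos_of_mem_Ioo ⟨by linarith, by linarith⟩
  have ht : Real.tan (t/2) ≠ 0 := by
    rw [Real.tan_eq_sin_div_cos]; positivity
  have h2 : HasDerivAt (fun t : ℝ => t/2) (1/2) t := (hasDerivAt_id t).div_const 2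
  have h3 : HasDerivAt (fun t : ℝ => Real.tan (t/2)) (1 / Real.cos (t/2) ^ 2 * (1/2)) t :=
    HasDerivAt.comp (h₂ := Real.tan) t (Real.hasDerivAt_tan hc.ne') h2
  have h := h3.log ht
  refine h.congr_deriv ?_
  have e : Real.sin t = 2 * Real.sin (t/2) * Real.cos (t/2) := by
    rw [← Real.sin_two_mul]; congr 1; ring
  rw [e]
  simp only [Real.tan_eq_sin_div_cos]
  field_simp

theorem helmholtz_solution_sin_branch (k a : ℝ) (hk : k ≠ 0)
    (A : ℝ → ℝ → ℝ)
    (hA : A = fun R θ => a * Real.log (Real.tan (θ/2)) * Real.sin (k*R) / R)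
    (R θ : ℝ) (hR : 0 < R) (hθ0 : 0 < θ) (hθπ : θ < Real.pi) :
    deriv (deriv (fun r => A r θ)) R + (2/R) * deriv (fun r => A r θ) R
      + (1/R^2) * (deriv (deriv (fun t => A R t)) θ
        + (Real.cos θ / Real.sin θ) * deriv (fun t => A R t) θ)
      + k^2 * A R θ = 0 := by
  subst hA
  have hs : 0 < Real.sin θ := Real.sin_pos_of_pos_of_lt_pi hθ0 hθπ
  dsimp only
  generalize hc : a * Real.log (Real.tan (θ/2)) = c
  have hkr : ∀ r : ℝ, HasDerivAt (fun r : ℝ => k * r) k r := fun r => by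
    simpa using (hasDerivAt_id r).const_mul k
  have hr1 : ∀ r : ℝ, 0 < r → HasDerivAt (fun r => c * Real.sin (k*r) / r)
      (c * (k * r * Real.cos (k*r) - Real.sin (k*r)) / r^2) r := by
    intro r hr
    refine ((((hkr r).sin).const_mul c).div (hasDerivAt_id r) hr.ne').congr_deriv ?_
    simp only [id]
    ring
  have hr2 : HasDerivAt (fun r => c * (k * r * Real.cos (k*r) - Real.sin (k*r)) / r^2)
      (c * (-k^2 * R * Real.sin (k*R)) / R^2
        - 2 * c * (k * R * Real.cos (k*R) - Real.sin (k*R)) / R^3) R := by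
    refine (((((hkr R).mul (hkr R).cos).sub (hkr R).sin).const_mul c).div
      (hasDerivAt_pow 2 R) (pow_ne_zero 2 hR.ne')).congr_deriv ?_
    simp only [Pi.mul_apply, Pi.sub_apply]
    field_simp
    push_cast
    ring
  have er : deriv (deriv (fun r => c * Real.sin (k*r) / r)) R =
      c * (-k^2 * R * Real.sin (k*R)) / R^2
        - 2 * c * (k * R * Real.cos (k*R) - Real.sin (k*R)) / R^3 := by
    refine (Filter.EventuallyEq.deriv_eq ?_).trans hr2.deriv
    filter_upwards [lt_mem_nhds hR] with r hr using (hr1 r hr).deriv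
  have ht1 : ∀ t : ℝ, 0 < t → t < Real.pi →
      HasDerivAt (fun t => a * Real.log (Real.tan (t/2)) * Real.sin (k*R) / R)
      (a * (1 / Real.sin t) * Real.sin (k*R) / R) t := fun t h0 h1 =>
    (((helmholtz_aux_log h0 h1).const_mul a).mul_const _).div_const _
  have ht2 : HasDerivAt (fun t => a * (1 / Real.sin t) * Real.sin (k*R) / R)
      (a * (-Real.cos θ / Real.sin θ ^ 2) * Real.sin (k*R) / R) θ := by
    have := (Real.hasDerivAt_sin θ).inv hs.ne'
    simpa only [one_div, Pi.inv_apply] using ((this.const_mul a).mul_const (Real.sin (k*R))).div_const R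
  have et : deriv (deriv (fun t => a * Real.log (Real.tan (t/2)) * Real.sin (k*R) / R)) θ =
      a * (-Real.cos θ / Real.sin θ ^ 2) * Real.sin (k*R) / R := by
    refine (Filter.EventuallyEq.deriv_eq ?_).trans ht2.deriv
    filter_upwards [lt_mem_nhds hθ0, gt_mem_nhds hθπ] with t h0 h1 using (ht1 t h0 h1).deriv
  rw [er, et, (hr1 R hR).deriv, (ht1 θ hθ0 hθπ).deriv]
  field_simp
  ring
end

section
/- Define f₂ : ℝ → ℂ by f₂ θ = -Complex.I * Complex.log ((Real.log (Real.tan (θ/2)) : ℂ)). Then for every θ with 0 < θ < π and θ ≠ π/2, deriv (deriv f₂) θ + Complex.I * (deriv f₂ θ)^2 + (Real.cos θ / Real.sin θ) * deriv f₂ θ = 0. -/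
lemma hasDerivAt_clog_real (x : ℝ) (hx : x ≠ 0) :
    HasDerivAt (fun y : ℝ => Complex.log (y : ℂ)) ((x⁻¹ : ℝ) : ℂ) x := by
  have h := (Real.hasDerivAt_log hx).ofReal_comp
  rcases lt_or_gt_of_ne hx with h0 | h0
  · refine (h.add_const ((Real.pi : ℂ) * Complex.I)).congr_of_eventuallyEq ?_
    filter_upwards [Iio_mem_nhds h0] with y hy
    rw [Complex.log, Complex.arg_ofReal_of_neg hy, Complex.norm_real, Real.norm_eq_abs,
      Real.log_abs]
  · refine h.congr_of_eventuallyEq ?_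
    filter_upwards [Ioi_mem_nhds h0] with y hy
    exact (Complex.ofReal_log (le_of_lt hy)).symm

lemma hasDerivAt_logtan (θ : ℝ) (h0 : 0 < θ) (hp : θ < Real.pi) :
    HasDerivAt (fun t : ℝ => Real.log (Real.tan (t / 2))) (Real.sin θ)⁻¹ θ := by
  have hs : 0 < Real.sin (θ / 2) := Real.sin_pos_of_pos_of_lt_pi (by linarith) (by linarith)
  have hc : 0 < Real.cos (θ / 2) := Real.cos_pos_of_mem_Ioo ⟨by linarith, by linarith⟩
  have ht : Real.tan (θ / 2) ≠ 0 := by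
    rw [Real.tan_eq_sin_div_cos]; positivity
  have h1 : HasDerivAt (fun t : ℝ => Real.tan (t / 2)) (1 / Real.cos (θ / 2) ^ 2 * (1 / 2)) θ :=
    HasDerivAt.comp (h := fun t : ℝ => t / 2) θ (Real.hasDerivAt_tan hc.ne')
      ((hasDerivAt_id θ).div_const 2)
  convert h1.log ht using 1
  have e : Real.sin θ = 2 * Real.sin (θ / 2) * Real.cos (θ / 2) := by
    rw [← Real.sin_two_mul]; congr 1; ring
  rw [e, Real.tan_eq_sin_div_cos]
  field_simp

lemma logtan_ne (θ : ℝ) (h0 : 0 < θ) (hp : θ < Real.pi) (hh : θ ≠ Real.pi / 2) :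
    Real.log (Real.tan (θ / 2)) ≠ 0 := by
  have ht : 0 < Real.tan (θ / 2) := Real.tan_pos_of_pos_of_lt_pi_div_two (by linarith) (by linarith)
  apply Real.log_ne_zero_of_pos_of_ne_one ht
  intro h
  apply hh
  have := Real.arctan_tan (x := θ / 2) (by linarith) (by linarith)
  rw [h, Real.arctan_one] at this
  linarith

theorem angular_phase_equation (f₂ : ℝ → ℂ)
    (hf : f₂ = fun θ => -Complex.I * Complex.log ((Real.log (Real.tan (θ/2)) : ℂ)))
    (θ : ℝ) (hθ0 : 0 < θ) (hθπ : θ < Real.pi) (hθhalf : θ ≠ Real.pi/2) :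
    deriv (deriv f₂) θ + Complex.I * (deriv f₂ θ)^2
      + ((Real.cos θ / Real.sin θ : ℝ) : ℂ) * deriv f₂ θ = 0 := by
  have key : ∀ t : ℝ, 0 < t → t < Real.pi → t ≠ Real.pi / 2 →
      deriv f₂ t = -Complex.I * (((Real.log (Real.tan (t / 2)) * Real.sin t)⁻¹ : ℝ) : ℂ) := by
    intro t h0 hp hh
    have h := ((hasDerivAt_clog_real _ (logtan_ne t h0 hp hh)).scomp t
      (hasDerivAt_logtan t h0 hp)).const_mul (-Complex.I)
    rw [hf]
    refine h.deriv.trans ?_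
    rw [Complex.real_smul, ← Complex.ofReal_mul, mul_inv, mul_comm (Real.sin t)⁻¹]
  have ev : deriv f₂ =ᶠ[nhds θ]
      fun t => -Complex.I * (((Real.log (Real.tan (t / 2)) * Real.sin t)⁻¹ : ℝ) : ℂ) := by
    filter_upwards [Ioi_mem_nhds hθ0, Iio_mem_nhds hθπ, isOpen_ne.mem_nhds hθhalf] with t a b c
    exact key t a b c
  have hL := logtan_ne θ hθ0 hθπ hθhalf
  have hs : Real.sin θ ≠ 0 := (Real.sin_pos_of_pos_of_lt_pi hθ0 hθπ).ne'
  have h2 := ((((hasDerivAt_logtan θ hθ0 hθπ).mul (Real.hasDerivAt_sin θ)).inv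
    (mul_ne_zero hL hs)).ofReal_comp).const_mul (-Complex.I)
  have h3 := ev.deriv_eq.trans h2.deriv
  rw [h3, key θ hθ0 hθπ hθhalf]
  simp only [Pi.mul_apply]
  generalize Real.log (Real.tan (θ / 2)) = L at *
  generalize Real.sin θ = s at *
  generalize Real.cos θ = c at *
  have hL' : (L : ℂ) ≠ 0 := by exact_mod_cast hL
  have hs' : (s : ℂ) ≠ 0 := by exact_mod_cast hs
  push_cast
  rw [mul_pow (-Complex.I), neg_sq, Complex.I_sq]
  field_simp
  ring
end

section
/- Let k : ℝ and define f₁ : ℝ → ℂ by f₁ R = -Complex.I * Complex.log (Complex.sinh (Complex.I * k * R)) + Complex.I * Real.log R. Then for every R > 0 with Real.sin (k*R) ≠ 0, deriv (deriv f₁) R + Complex.I * (deriv f₁ R)^2 + (2/R) * deriv f₁ R - Complex.I * k^2 = 0. -/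
theorem sinh_aux (k x : ℝ) : Complex.sinh (Complex.I * k * x) = (Real.sin (k*x) : ℂ) * Complex.I := by
  rw [show Complex.I * (k:ℂ) * x = ((k*x : ℝ) : ℂ) * Complex.I by push_cast; ring,
    Complex.sinh_mul_I, Complex.ofReal_sin]

theorem sinh_ne_aux (k x : ℝ) (h : Real.sin (k*x) ≠ 0) :
    Complex.sinh (Complex.I * k * x) ≠ 0 := by
  rw [sinh_aux]
  exact mul_ne_zero (by exact_mod_cast h) Complex.I_ne_zero

theorem lin_aux (k x : ℝ) :
    HasDerivAt (fun R : ℝ => Complex.I * (k:ℂ) * (R:ℂ)) (Complex.I * k) x := by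
  simpa using (Complex.ofRealCLM.hasDerivAt (x := x)).const_mul (Complex.I * (k:ℂ))

theorem sinh_deriv_aux (k x : ℝ) :
    HasDerivAt (fun R : ℝ => Complex.sinh (Complex.I * (k:ℂ) * (R:ℂ)))
      (Complex.cosh (Complex.I * k * x) * (Complex.I * k)) x :=
  (Complex.hasDerivAt_sinh _).comp x (lin_aux k x)

theorem cosh_deriv_aux (k x : ℝ) :
    HasDerivAt (fun R : ℝ => Complex.cosh (Complex.I * (k:ℂ) * (R:ℂ)))
      (Complex.sinh (Complex.I * k * x) * (Complex.I * k)) x :=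
  (Complex.hasDerivAt_cosh _).comp x (lin_aux k x)

theorem first_aux (k x : ℝ) (hx : 0 < x) (h : Real.sin (k*x) ≠ 0) :
    HasDerivAt (fun R : ℝ =>
      -Complex.I * Complex.log (Complex.sinh (Complex.I * k * R))
        + Complex.I * (Real.log R : ℂ))
      (k * (Complex.cosh (Complex.I * k * x) / Complex.sinh (Complex.I * k * x))
        + Complex.I * (x:ℂ)⁻¹) x := by
  have hs : Complex.sinh (Complex.I * k * x) ∈ Complex.slitPlane := by
    rw [sinh_aux]
    right
    simpa [← Complex.ofReal_mul, ← Complex.ofReal_sin, Complex.ofReal_re] using h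
  have h1 := ((sinh_deriv_aux k x).clog_real hs).const_mul (-Complex.I)
  have h2 := ((Real.hasDerivAt_log hx.ne').ofReal_comp).const_mul Complex.I
  refine (h1.add h2).congr_deriv ?_
  push_cast
  linear_combination (-(k:ℂ) * (Complex.cosh (Complex.I * k * x) / Complex.sinh (Complex.I * k * x))) * Complex.I_sq

theorem radial_phase_equation_sinh (k : ℝ) (f₁ : ℝ → ℂ)
    (hf : f₁ = fun R : ℝ =>
      -Complex.I * Complex.log (Complex.sinh (Complex.I * k * R))
        + Complex.I * (Real.log R : ℂ))
    (R : ℝ) (hR : 0 < R) (hsin : Real.sin (k*R) ≠ 0) :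
    deriv (deriv f₁) R + Complex.I * (deriv f₁ R)^2
      + (2/(R:ℂ)) * deriv f₁ R - Complex.I * (k:ℂ)^2 = 0 := by
  subst hf
  have hev : ∀ᶠ x : ℝ in nhds R, 0 < x ∧ Real.sin (k*x) ≠ 0 := by
    refine (lt_mem_nhds hR).and ?_
    have hc : ContinuousAt (fun x : ℝ => Real.sin (k*x)) R := by fun_prop
    exact hc.eventually_ne hsin
  have hE := hev.mono fun x hx => (first_aux k x hx.1 hx.2).deriv
  have hS := sinh_ne_aux k R hsin
  have hR0 : (R:ℂ) ≠ 0 := by exact_mod_cast hR.ne'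
  have hinv : HasDerivAt (fun x : ℝ => (x:ℂ)⁻¹) (-1 / (R:ℂ)^2) R := by
    simpa using (Complex.ofRealCLM.hasDerivAt (x := R)).fun_inv (by simpa using hR.ne')
  have h2 := ((((cosh_deriv_aux k R)).fun_div ((sinh_deriv_aux k R)) hS).const_mul (k:ℂ)).fun_add
    (hinv.const_mul Complex.I)
  rw [Filter.EventuallyEq.deriv_eq hE, h2.deriv, (first_aux k R hR hsin).deriv]
  generalize Complex.sinh (Complex.I * k * R) = s at *
  generalize Complex.cosh (Complex.I * k * R) = c at *
  field_simp
  ring_nf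
  simp only [show Complex.I^3 = -Complex.I by rw [pow_succ, Complex.I_sq]; ring, Complex.I_sq]
  ring
end
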